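/- Let F be the CDF of the symmetric Pareto distribution with shape 2 and define φ₂(c) = ∫_{-∞}^∞ f(z+c) F(z) F(z+c) dz (probability of selecting arm 2 among three arms with loss vector (0,c,c), f(x) = 1/(|x|+1)^3). Then for all c ≥ 0: F(-c)/4 ≤ φ₂(c) ≤ (3 + 1/16)/(c+1)^2, where F(-c) = 1/(2(c+1)^2). -/

import Mathlib

open Real MeasureTheory

/-- Density of the symmetric Pareto distribution with shape 2. -/
noncomputable def sParetoPdf (x : ℝ) : ℝ := 1 / (|x| + 1) ^ 3

/-- CDF of the symmetric Pareto distribution with shape 2. -/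
noncomputable def sParetoCdf (x : ℝ) : ℝ :=
  if x < 0 then 1 / (2 * (1 - x) ^ 2) else 1 - 1 / (2 * (x + 1) ^ 2)

lemma sParetoPdf_nonneg (x : ℝ) : 0 ≤ sParetoPdf x := by
  unfold sParetoPdf
  positivity

lemma sParetoCdf_of_nonpos {x : ℝ} (hx : x ≤ 0) : sParetoCdf x = 1 / (2 * (1 - x) ^ 2) := by
  rcases hx.lt_or_eq with h | rfl
  · simp [sParetoCdf, h]
  · norm_num [sParetoCdf]

lemma sParetoCdf_of_nonneg {x : ℝ} (hx : 0 ≤ x) :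
    sParetoCdf x = 1 - 1 / (2 * (x + 1) ^ 2) := by
  simp [sParetoCdf, not_lt.mpr hx]

lemma sParetoCdf_monotone : Monotone sParetoCdf := by
  refine MonotoneOn.Iic_union_Ici (a := 0) ?_ ?_
  · intro x hx y hy hxy
    simp only [Set.mem_Iic] at hx hy
    rw [sParetoCdf_of_nonpos hx, sParetoCdf_of_nonpos hy]
    have : 0 < 1 - y := by linarith
    gcongr
  · intro x hx y hy hxy
    simp only [Set.mem_Ici] at hx hy
    rw [sParetoCdf_of_nonneg hx, sParetoCdf_of_nonneg hy]
    gcongr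

lemma sParetoCdf_nonneg (x : ℝ) : 0 ≤ sParetoCdf x := by
  refine le_trans ?_ (sParetoCdf_monotone (min_le_left x 0))
  rw [sParetoCdf_of_nonpos (min_le_right x 0)]
  positivity

lemma sParetoCdf_le_one (x : ℝ) : sParetoCdf x ≤ 1 := by
  refine (sParetoCdf_monotone (le_max_left x 0)).trans ?_
  rw [sParetoCdf_of_nonneg (le_max_right x 0), sub_le_self_iff]
  positivity

lemma half_le_sParetoCdf {x : ℝ} (hx : 0 ≤ x) : 1 / 2 ≤ sParetoCdf x := by
  refine le_trans ?_ (sParetoCdf_monotone hx)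
  norm_num [sParetoCdf]

lemma hasDerivAt_sParetoPdf_primitive {x : ℝ} (hx : 0 ≤ x) :
    HasDerivAt (fun y : ℝ ↦ -(2 * (y + 1) ^ 2)⁻¹) (sParetoPdf x) x := by
  have hx' : x + 1 ≠ 0 := by positivity
  have h := (((((hasDerivAt_id x).add_const 1).pow 2).const_mul 2).inv
    (by simpa using hx')).neg
  refine HasDerivAt.congr_deriv (f := fun y : ℝ ↦ -(2 * (y + 1) ^ 2)⁻¹) h ?_
  simp only [sParetoPdf, abs_of_nonneg hx, id, Pi.pow_apply]
  field_simp
  norm_num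

lemma tendsto_sParetoPdf_primitive :
    Filter.Tendsto (fun y : ℝ ↦ -(2 * (y + 1) ^ 2)⁻¹) Filter.atTop (nhds 0) := by
  rw [← neg_zero]
  refine (Filter.Tendsto.inv_tendsto_atTop ?_).neg
  refine Filter.Tendsto.const_mul_atTop two_pos ?_
  exact (Filter.tendsto_pow_atTop two_ne_zero).comp
    (Filter.tendsto_atTop_add_const_right _ _ Filter.tendsto_id)

lemma integrableOn_Ioi_sParetoPdf {a : ℝ} (ha : 0 ≤ a) :
    IntegrableOn sParetoPdf (Set.Ioi a) :=
  integrableOn_Ioi_deriv_of_nonneg'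
    (fun _ hx ↦ hasDerivAt_sParetoPdf_primitive (ha.trans hx))
    (fun x _ ↦ sParetoPdf_nonneg x) tendsto_sParetoPdf_primitive

lemma integral_Ioi_sParetoPdf {a : ℝ} (ha : 0 ≤ a) :
    ∫ x in Set.Ioi a, sParetoPdf x = 1 / (2 * (a + 1) ^ 2) := by
  rw [integral_Ioi_of_hasDerivAt_of_nonneg'
    (fun _ hx ↦ hasDerivAt_sParetoPdf_primitive (ha.trans hx))
    (fun x _ ↦ sParetoPdf_nonneg x) tendsto_sParetoPdf_primitive]
  simp

lemma integral_sParetoPdf : ∫ x, sParetoPdf x = 1 := by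
  have h := integral_comp_abs (f := sParetoPdf)
  rw [integral_Ioi_sParetoPdf le_rfl] at h
  simpa [sParetoPdf] using h

lemma integrable_sParetoPdf : Integrable sParetoPdf :=
  .of_integral_ne_zero (by rw [integral_sParetoPdf]; exact one_ne_zero)

lemma integrable_sParetoPdf_mul_sParetoCdf (c : ℝ) :
    Integrable fun x ↦ sParetoPdf x * sParetoCdf (x - c) * sParetoCdf x := by
  have hF : Measurable sParetoCdf := sParetoCdf_monotone.measurable
  refine integrable_sParetoPdf.mono' ?_ (ae_of_all _ fun x ↦ ?_)
  · exact (integrable_sParetoPdf.aestronglyMeasurable.mul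
      (hF.comp (measurable_id.sub_const c)).aestronglyMeasurable).mul hF.aestronglyMeasurable
  · have h0 := sParetoPdf_nonneg x
    have h1 := sParetoCdf_nonneg x
    have h2 := sParetoCdf_nonneg (x - c)
    rw [Real.norm_of_nonneg (by positivity)]
    exact (mul_le_of_le_one_right (by positivity) (sParetoCdf_le_one x)).trans
      (mul_le_of_le_one_right h0 (sParetoCdf_le_one _))

lemma sParetoPdf_mul_sParetoCdf_le {c x : ℝ} (hc : 0 ≤ c) (hx : x ≤ c) :
    sParetoPdf x * sParetoCdf (x - c) ≤
      (sParetoPdf x + 1 / 4 * (1 + (x - c) ^ 2)⁻¹) / (c + 1) ^ 2 := by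
  rcases le_total x 0 with h | h
  · have h1 : sParetoCdf (x - c) ≤ 1 / (c + 1) ^ 2 := by
      rw [sParetoCdf_of_nonpos (by linarith)]
      gcongr
      nlinarith
    calc sParetoPdf x * sParetoCdf (x - c) ≤ sParetoPdf x * (1 / (c + 1) ^ 2) :=
          mul_le_mul_of_nonneg_left h1 (sParetoPdf_nonneg x)
      _ = sParetoPdf x / (c + 1) ^ 2 := by ring
      _ ≤ _ := by
          gcongr
          exact le_add_of_nonneg_right (by positivity)
  · have hd : 0 ≤ c - x := by linarith
    have hF : sParetoCdf (x - c) ≤ (x ^ 2 / (1 + c - x) ^ 2 + 1) / (c + 1) ^ 2 := by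
      rw [sParetoCdf_of_nonpos (by linarith)]
      have : 0 < 1 + c - x := by linarith
      rw [show 1 - (x - c) = 1 + c - x by ring, div_add_one (by positivity), div_div,
        div_le_div_iff₀ (by positivity) (by positivity)]
      nlinarith [mul_nonneg (sq_nonneg (1 + c - x)) (sq_nonneg (x - (1 + c - x)))]
    have hsq : x ^ 2 * sParetoPdf x ≤ 1 / 4 := by
      rw [sParetoPdf, abs_of_nonneg h, mul_one_div, div_le_div_iff₀ (by positivity) (by norm_num)]
      nlinarith [mul_nonneg h (sq_nonneg (x - 1)), sq_nonneg (x - 1)]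
    have hk : 1 / (1 + c - x) ^ 2 ≤ (1 + (x - c) ^ 2)⁻¹ := by
      rw [← one_div]
      gcongr
      nlinarith
    calc sParetoPdf x * sParetoCdf (x - c)
        ≤ sParetoPdf x * ((x ^ 2 / (1 + c - x) ^ 2 + 1) / (c + 1) ^ 2) :=
          mul_le_mul_of_nonneg_left hF (sParetoPdf_nonneg x)
      _ = (sParetoPdf x + x ^ 2 * sParetoPdf x * (1 / (1 + c - x) ^ 2)) / (c + 1) ^ 2 := by ring
      _ ≤ _ := by gcongr

lemma le_integral_sParetoPdf_mul_sParetoCdf (c : ℝ) :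
    sParetoCdf (-c) / 4 ≤ ∫ x, sParetoPdf x * sParetoCdf (x - c) * sParetoCdf x := by
  have hnn (x : ℝ) : 0 ≤ sParetoPdf x * sParetoCdf (x - c) * sParetoCdf x :=
    mul_nonneg (mul_nonneg (sParetoPdf_nonneg x) (sParetoCdf_nonneg _)) (sParetoCdf_nonneg x)
  have hint := integrable_sParetoPdf_mul_sParetoCdf c
  calc sParetoCdf (-c) / 4
      = ∫ x in Set.Ioi 0, sParetoPdf x * (sParetoCdf (-c) * (1 / 2)) := by
        rw [integral_mul_const, integral_Ioi_sParetoPdf le_rfl]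
        ring
    _ ≤ ∫ x in Set.Ioi 0, sParetoPdf x * sParetoCdf (x - c) * sParetoCdf x := by
        refine setIntegral_mono_on ((integrableOn_Ioi_sParetoPdf le_rfl).mul_const _)
          hint.integrableOn measurableSet_Ioi fun x hx ↦ ?_
        have hx0 : 0 ≤ x := le_of_lt hx
        rw [mul_assoc]
        exact mul_le_mul_of_nonneg_left
          (mul_le_mul (sParetoCdf_monotone (by linarith)) (half_le_sParetoCdf hx0)
            (by norm_num) (sParetoCdf_nonneg _)) (sParetoPdf_nonneg x)
    _ ≤ _ := setIntegral_le_integral hint (ae_of_all _ hnn)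

lemma integral_sParetoPdf_mul_sParetoCdf_le {c : ℝ} (hc : 0 ≤ c) :
    ∫ x, sParetoPdf x * sParetoCdf (x - c) * sParetoCdf x ≤ (3 + 1 / 16) / (c + 1) ^ 2 := by
  have hint := integrable_sParetoPdf_mul_sParetoCdf c
  have hle (x : ℝ) : sParetoPdf x * sParetoCdf (x - c) * sParetoCdf x ≤
      sParetoPdf x * sParetoCdf (x - c) :=
    mul_le_of_le_one_right (mul_nonneg (sParetoPdf_nonneg x) (sParetoCdf_nonneg _))
      (sParetoCdf_le_one x)
  have hk : Integrable fun x : ℝ ↦ 1 / 4 * (1 + (x - c) ^ 2)⁻¹ :=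
    (integrable_inv_one_add_sq.comp_sub_right c).const_mul _
  have hg : Integrable fun x ↦
      (sParetoPdf x + 1 / 4 * (1 + (x - c) ^ 2)⁻¹) / (c + 1) ^ 2 :=
    (integrable_sParetoPdf.add hk).div_const _
  have hleft : ∫ x in Set.Iic c, sParetoPdf x * sParetoCdf (x - c) * sParetoCdf x ≤
      (1 + 1 / 4 * π) / (c + 1) ^ 2 := by
    calc _ ≤ ∫ x in Set.Iic c, (sParetoPdf x + 1 / 4 * (1 + (x - c) ^ 2)⁻¹) / (c + 1) ^ 2 :=
          setIntegral_mono_on hint.integrableOn hg.integrableOn measurableSet_Iic fun x hx ↦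
            (hle x).trans (sParetoPdf_mul_sParetoCdf_le hc hx)
      _ ≤ ∫ x, (sParetoPdf x + 1 / 4 * (1 + (x - c) ^ 2)⁻¹) / (c + 1) ^ 2 :=
          setIntegral_le_integral hg (ae_of_all _ fun x ↦
            div_nonneg (add_nonneg (sParetoPdf_nonneg x) (by positivity)) (by positivity))
      _ = _ := by
          rw [integral_div, integral_add integrable_sParetoPdf hk, integral_sParetoPdf,
            integral_const_mul, integral_sub_right_eq_self (fun x : ℝ ↦ (1 + x ^ 2)⁻¹) c,
            integral_univ_inv_one_add_sq]
  have hright : ∫ x in Set.Ioi c, sParetoPdf x * sParetoCdf (x - c) * sParetoCdf x ≤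
      1 / (2 * (c + 1) ^ 2) := by
    rw [← integral_Ioi_sParetoPdf hc]
    exact setIntegral_mono hint.integrableOn integrable_sParetoPdf.integrableOn fun x ↦
      (hle x).trans (mul_le_of_le_one_right (sParetoPdf_nonneg x) (sParetoCdf_le_one _))
  rw [← intervalIntegral.integral_Iic_add_Ioi (b := c) hint.integrableOn hint.integrableOn]
  calc _ ≤ (1 + 1 / 4 * π) / (c + 1) ^ 2 + 1 / (2 * (c + 1) ^ 2) := add_le_add hleft hright
    _ = (3 / 2 + 1 / 4 * π) / (c + 1) ^ 2 := by
        field_simp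
        ring
    _ ≤ _ := by
        refine div_le_div_of_nonneg_right ?_ (by positivity)
        linarith [pi_le_four]

theorem stmt18 (c : ℝ) (hc : 0 ≤ c) :
    (sParetoCdf (-c) / 4 ≤ ∫ z : ℝ, sParetoPdf (z + c) * sParetoCdf z * sParetoCdf (z + c)) ∧
    ((∫ z : ℝ, sParetoPdf (z + c) * sParetoCdf z * sParetoCdf (z + c)) ≤
        (3 + 1 / 16) / (c + 1) ^ 2) ∧
    sParetoCdf (-c) = 1 / (2 * (c + 1) ^ 2) := by
  have hshift : ∫ z : ℝ, sParetoPdf (z + c) * sParetoCdf z * sParetoCdf (z + c) =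
      ∫ x, sParetoPdf x * sParetoCdf (x - c) * sParetoCdf x := by
    rw [← integral_add_right_eq_self
      (fun x ↦ sParetoPdf x * sParetoCdf (x - c) * sParetoCdf x) c]
    simp only [add_sub_cancel_right]
  rw [hshift]
  refine ⟨le_integral_sParetoPdf_mul_sParetoCdf c, integral_sParetoPdf_mul_sParetoCdf_le hc, ?_⟩
  rw [sParetoCdf_of_nonpos (by linarith)]
  ring
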